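/- arXiv:1609.09281 — 14 statements merged into one kernel-verified Lean document; each statement's English description precedes it below -/
import Mathlib

section
/- For every correct node v ∈ C, the output of the approximate agreement step satisfies min_{w∈C} x_w − δ ≤ y_v ≤ max_{w∈C} x_w + δ. -/
/-- The `k`-th smallest element (1-indexed) of a multiset of reals. -/
noncomputable def kthSmallest (s : Multiset ℝ) (k : ℕ) : ℝ :=
  (s.sort (· ≤ ·)).getD (k - 1) 0

/-- If fewer than `k` elements of `s` are below `a`, the `k`-th smallest is at least `a`. -/
theorem le_kthSmallest {s : Multiset ℝ} {k : ℕ} {a : ℝ}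
    (hk : s.countP (· < a) < k) (hks : k ≤ s.card) : a ≤ kthSmallest s k := by
  have hlen : k - 1 < (s.sort (· ≤ ·)).length := by
    rw [Multiset.length_sort]; omega
  have hsorted := (s.pairwise_sort (· ≤ ·)).sortedLE
  rw [← s.sort_eq (· ≤ ·), Multiset.coe_countP] at hk
  rw [kthSmallest, List.getD_eq_getElem _ _ hlen]
  by_contra! hlt
  have hcount : ((s.sort (· ≤ ·)).take k).countP (· < a) = ((s.sort (· ≤ ·)).take k).length := by
    rw [List.countP_eq_length]
    intro b hb
    obtain ⟨i, hi, rfl⟩ := List.mem_iff_getElem.mp hb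
    rw [List.length_take] at hi
    rw [List.getElem_take]
    exact decide_eq_true ((hsorted.getElem_le_getElem_of_le (by omega)).trans_lt hlt)
  have hle := (List.take_sublist k (s.sort (· ≤ ·))).countP_le (p := fun b => decide (b < a))
  rw [hcount, List.length_take, Multiset.length_sort] at hle
  omega

/-- If at most `s.card - k` elements of `s` exceed `a`, the `k`-th smallest is at most `a`. -/
theorem kthSmallest_le {s : Multiset ℝ} {k : ℕ} {a : ℝ}
    (hk : 1 ≤ k) (hks : s.countP (a < ·) + k ≤ s.card) : kthSmallest s k ≤ a := by
  have hlen : k - 1 < (s.sort (· ≤ ·)).length := by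
    rw [Multiset.length_sort]; omega
  have hsorted := (s.pairwise_sort (· ≤ ·)).sortedLE
  have hcard := s.length_sort (· ≤ ·)
  rw [← hcard] at hks
  nth_rewrite 1 [← s.sort_eq (· ≤ ·)] at hks
  rw [Multiset.coe_countP] at hks
  rw [kthSmallest, List.getD_eq_getElem _ _ hlen]
  by_contra! hlt
  have hcount : ((s.sort (· ≤ ·)).drop (k - 1)).countP (a < ·) =
      ((s.sort (· ≤ ·)).drop (k - 1)).length := by
    rw [List.countP_eq_length]
    intro b hb
    obtain ⟨i, hi, rfl⟩ := List.mem_iff_getElem.mp hb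
    rw [List.getElem_drop]
    exact decide_eq_true (hlt.trans_le (hsorted.getElem_le_getElem_of_le (by omega)))
  have hle := (List.drop_sublist (k - 1) (s.sort (· ≤ ·))).countP_le
    (p := fun b => decide (a < b))
  rw [hcount, List.length_drop] at hle
  omega

/-- If no element of `C` has a value satisfying `p`, at most `|V| - |C|` values satisfy `p`. -/
theorem countP_map_univ_le {V α : Type*} [Fintype V] (C : Finset V) (g : V → α)
    (p : α → Prop) [DecidablePred p] (hp : ∀ w ∈ C, ¬ p (g w)) :
    ((Finset.univ : Finset V).val.map g).countP p ≤ Fintype.card V - C.card := by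
  classical
  rw [Multiset.countP_map, ← Finset.card_compl]
  change (Finset.univ.filter fun w => p (g w)).card ≤ _
  refine Finset.card_le_card fun w hw => ?_
  rw [Finset.mem_compl]
  exact fun hwC => hp w hwC (Finset.mem_filter.mp hw).2

/-- Validity of an approximate agreement step: the output of every correct node
lies within the range spanned by the correct nodes' inputs, enlarged by `δ`. -/
theorem approx_agreement_validity
    {V : Type*} [Fintype V]
    (C : Finset V) (f : ℕ)
    (hf : 3 * f < Fintype.card V)
    (hC : C.card = Fintype.card V - f)
    (hCne : C.Nonempty)
    (δ : ℝ) (hδ : 0 ≤ δ)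
    (x : V → ℝ) (xhat : V → V → ℝ)
    (hest : ∀ v ∈ C, ∀ w ∈ C, |xhat w v - x w| ≤ δ)
    (y : V → ℝ)
    (hy : ∀ v ∈ C, y v =
      (kthSmallest ((Finset.univ : Finset V).val.map (fun w => xhat w v)) (f + 1)
        + kthSmallest ((Finset.univ : Finset V).val.map (fun w => xhat w v))
            (Fintype.card V - f)) / 2)
    (v : V) (hv : v ∈ C) :
    C.inf' hCne x - δ ≤ y v ∧ y v ≤ C.sup' hCne x + δ := by
  have hcard : ((Finset.univ : Finset V).val.map fun w => xhat w v).card = Fintype.card V := by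
    simp
  have hlow := countP_map_univ_le C (fun w => xhat w v) (· < C.inf' hCne x - δ) fun w hw => by
    have := abs_le.mp (hest v hv w hw)
    have := Finset.inf'_le x hw
    rw [not_lt]; linarith
  have hhigh := countP_map_univ_le C (fun w => xhat w v) (C.sup' hCne x + δ < ·) fun w hw => by
    have := abs_le.mp (hest v hv w hw)
    have := Finset.le_sup' x hw
    rw [not_lt]; linarith
  have hl (k : ℕ) (hk : f < k) (hkn : k ≤ Fintype.card V) :=
    le_kthSmallest (s := (Finset.univ : Finset V).val.map fun w => xhat w v)
      (k := k) (a := C.inf' hCne x - δ) (by omega) (by omega)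
  have hu (k : ℕ) (hk : 1 ≤ k) (hkn : k + f ≤ Fintype.card V) :=
    kthSmallest_le (s := (Finset.univ : Finset V).val.map fun w => xhat w v)
      (k := k) (a := C.sup' hCne x + δ) hk (by omega)
  rw [hy v hv]
  have h₁ := hl (f + 1) (by omega) (by omega)
  have h₂ := hl (Fintype.card V - f) (by omega) (by omega)
  have h₃ := hu (f + 1) (by omega) (by omega)
  have h₄ := hu (Fintype.card V - f) (by omega) (by omega)
  constructor <;> linarith
end

section
/- For every correct node v ∈ C, the correction applied by the approximate agreement step satisfies |y_v − x_v| ≤ ‖x‖ + δ, where ‖x‖ := max_{w∈C} x_w − min_{w∈C} x_w is the diameter of the correct inputs. -/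
theorem kthSmallest_le_of_le_countP {s : Multiset ℝ} {k : ℕ} {b : ℝ} (hk : 0 < k)
    (h : k ≤ s.countP (· ≤ b)) : kthSmallest s k ≤ b := by
  have hlen : (s.sort (· ≤ ·)).length = s.card := Multiset.length_sort _
  have hcount : s.countP (· ≤ b) = (s.sort (· ≤ ·)).countP (· ≤ b) := by
    rw [← Multiset.coe_countP, Multiset.sort_eq]
  have hsort : (s.sort (· ≤ ·)).Pairwise (· ≤ ·) := Multiset.pairwise_sort _ _
  have hcard : s.countP (· ≤ b) ≤ s.card := Multiset.countP_le_card _ _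
  unfold kthSmallest
  generalize s.sort (· ≤ ·) = l at *
  have hlt : k - 1 < l.length := by omega
  rw [List.getD_eq_getElem _ _ hlt]
  by_contra! hb
  have hdrop : (l.drop (k - 1)).countP (· ≤ b) = 0 := by
    rw [List.countP_eq_zero]
    intro z hz
    obtain ⟨i, hi, rfl⟩ := List.getElem_of_mem hz
    rw [List.length_drop] at hi
    rw [List.getElem_drop]
    have := hsort.sortedLE.getElem_le_getElem_of_le
      (hi := hlt) (hj := (by omega : k - 1 + i < l.length)) (by omega)
    simpa using hb.trans_le this
  have hsplit : l.countP (· ≤ b) =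
      (l.take (k - 1)).countP (· ≤ b) + (l.drop (k - 1)).countP (· ≤ b) := by
    rw [← List.countP_append, List.take_append_drop]
  have htake : (l.take (k - 1)).countP (· ≤ b) ≤ (l.take (k - 1)).length :=
    List.countP_le_length
  rw [List.length_take] at htake
  omega

theorem le_kthSmallest_of_countP_lt {s : Multiset ℝ} {k : ℕ} {a : ℝ} (hk : k ≤ s.card)
    (h : s.countP (· < a) < k) : a ≤ kthSmallest s k := by
  have hlen : (s.sort (· ≤ ·)).length = s.card := Multiset.length_sort _
  have hcount : s.countP (· < a) = (s.sort (· ≤ ·)).countP (· < a) := by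
    rw [← Multiset.coe_countP, Multiset.sort_eq]
  have hsort : (s.sort (· ≤ ·)).Pairwise (· ≤ ·) := Multiset.pairwise_sort _ _
  unfold kthSmallest
  generalize s.sort (· ≤ ·) = l at *
  have hlt : k - 1 < l.length := by omega
  rw [List.getD_eq_getElem _ _ hlt]
  by_contra! ha
  have htake : (l.take k).countP (· < a) = (l.take k).length := by
    rw [List.countP_eq_length]
    intro z hz
    obtain ⟨i, hi, rfl⟩ := List.getElem_of_mem hz
    rw [List.length_take] at hi
    rw [List.getElem_take]
    have := hsort.sortedLE.getElem_le_getElem_of_le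
      (hi := (by omega : i < l.length)) (hj := hlt) (by omega)
    simpa using this.trans_lt ha
  have hsub : (l.take k).countP (· < a) ≤ l.countP (· < a) :=
    (List.take_sublist k l).countP_le
  rw [List.length_take] at htake
  omega

/-- If all but at most `f` of the values `g w` lie in `[a, b]`, then so does every order statistic
of `g` that is neither among the `f` smallest nor among the `f` largest. -/
theorem kthSmallest_map_mem_Icc {V : Type*} [Fintype V] {C : Finset V} {f k : ℕ} {g : V → ℝ}
    {a b : ℝ} (hC : Fintype.card V ≤ C.card + f) (hg : ∀ w ∈ C, g w ∈ Set.Icc a b)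
    (hfk : f < k) (hk : k + f ≤ Fintype.card V) :
    kthSmallest ((Finset.univ : Finset V).val.map g) k ∈ Set.Icc a b := by
  classical
  constructor
  · apply le_kthSmallest_of_countP_lt
    · simp only [Multiset.card_map, Finset.card_val, Finset.card_univ]
      omega
    · rw [Multiset.countP_map, ← Finset.filter_val, Finset.card_val]
      have hsub : Finset.univ.filter (fun w => g w < a) ⊆ Cᶜ := fun w hw =>
        Finset.mem_compl.2 fun hwC => ((Finset.mem_filter.1 hw).2).not_ge (hg w hwC).1
      have := Finset.card_le_card hsub
      rw [Finset.card_compl] at this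
      omega
  · apply kthSmallest_le_of_le_countP (by omega)
    rw [Multiset.countP_map, ← Finset.filter_val, Finset.card_val]
    have hsub : C ⊆ Finset.univ.filter (fun w => g w ≤ b) := fun w hw =>
      Finset.mem_filter.2 ⟨Finset.mem_univ w, (hg w hw).2⟩
    have := Finset.card_le_card hsub
    omega

/-- The correction applied by an approximate agreement step is bounded by the
diameter of the correct nodes' inputs plus the perturbation `δ`. -/
theorem approx_agreement_max_correction
    {V : Type*} [Fintype V]
    (C : Finset V) (f : ℕ)
    (hf : 3 * f < Fintype.card V)
    (hC : C.card = Fintype.card V - f)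
    (hCne : C.Nonempty)
    (δ : ℝ) (hδ : 0 ≤ δ)
    (x : V → ℝ) (xhat : V → V → ℝ)
    (hest : ∀ v ∈ C, ∀ w ∈ C, |xhat w v - x w| ≤ δ)
    (y : V → ℝ)
    (hy : ∀ v ∈ C, y v =
      (kthSmallest ((Finset.univ : Finset V).val.map (fun w => xhat w v)) (f + 1)
        + kthSmallest ((Finset.univ : Finset V).val.map (fun w => xhat w v))
            (Fintype.card V - f)) / 2)
    (v : V) (hv : v ∈ C) :
    |y v - x v| ≤ (C.sup' hCne x - C.inf' hCne x) + δ := by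
  have hmem : ∀ w ∈ C, xhat w v ∈ Set.Icc (C.inf' hCne x - δ) (C.sup' hCne x + δ) := by
    intro w hw
    have h := abs_le.1 (hest v hv w hw)
    have hinf := Finset.inf'_le x hw
    have hsup := Finset.le_sup' x hw
    constructor <;> linarith
  have hlow := kthSmallest_map_mem_Icc (k := f + 1) (f := f) (by omega) hmem
    (by omega) (by omega)
  have hhigh := kthSmallest_map_mem_Icc (k := Fintype.card V - f) (f := f) (by omega) hmem
    (by omega) (by omega)
  have hinf := Finset.inf'_le x hv
  have hsup := Finset.le_sup' x hv
  rw [hy v hv, abs_le]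
  constructor <;> linarith [hlow.1, hlow.2, hhigh.1, hhigh.2]
end

section
/- Let ϑ > 1 and let H : ℝ → ℝ satisfy t' − t ≤ H(t') − H(t) ≤ ϑ(t' − t) for all t ≤ t'. Let d ≥ U ≥ 0 and let p_v, p_w ∈ ℝ with |p_w − p_v| ≤ D for some D ≥ 0. Suppose t_{wv} ∈ [p_w + d − U, p_w + d] and t_{vv} ∈ [p_v + d − U, p_v + d], and set τ_{wv} := H(t_{wv}) and τ_{vv} := H(t_{vv}). Then |2(τ_{wv} − τ_{vv})/(ϑ+1) − (p_w − p_v)| ≤ ϑU + ((ϑ−1)/(ϑ+1))·D. -/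
/-- Scaling the elapsed time of a clock with rate in `[1, ϑ]` by the mean rate `(ϑ + 1) / 2`
approximates real time up to the relative error of the drift. -/
theorem abs_two_mul_sub_le_of_drift {ϑ : ℝ} {H : ℝ → ℝ}
    (hH : ∀ t t' : ℝ, t ≤ t' → t' - t ≤ H t' - H t ∧ H t' - H t ≤ ϑ * (t' - t)) (s t : ℝ) :
    |2 * (H t - H s) - (ϑ + 1) * (t - s)| ≤ (ϑ - 1) * |t - s| := by
  rcases le_total s t with h | h
  · obtain ⟨hlo, hhi⟩ := hH s t h
    rw [abs_of_nonneg (sub_nonneg.2 h), abs_le]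
    constructor <;> linarith
  · obtain ⟨hlo, hhi⟩ := hH t s h
    rw [abs_of_nonpos (sub_nonpos.2 h), abs_le]
    constructor <;> linarith

/-- Error bound for the phase-offset measurement of node `v` regarding node `w`
(Lemma 5 of the paper, with non-strict bounds). -/
theorem phase_measurement_error
    (ϑ d U D : ℝ) (H : ℝ → ℝ)
    (hϑ : 1 < ϑ)
    (hH : ∀ t t' : ℝ, t ≤ t' →
      t' - t ≤ H t' - H t ∧ H t' - H t ≤ ϑ * (t' - t))
    (hdU : U ≤ d) (hU : 0 ≤ U) (hD : 0 ≤ D)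
    (pv pw : ℝ) (hpD : |pw - pv| ≤ D)
    (twv tvv : ℝ)
    (htwv : pw + d - U ≤ twv ∧ twv ≤ pw + d)
    (htvv : pv + d - U ≤ tvv ∧ tvv ≤ pv + d)
    (τwv τvv : ℝ) (hτwv : τwv = H twv) (hτvv : τvv = H tvv) :
    |2 * (τwv - τvv) / (ϑ + 1) - (pw - pv)| ≤
      ϑ * U + ((ϑ - 1) / (ϑ + 1)) * D := by
  subst hτwv hτvv
  have hx : |(twv - tvv) - (pw - pv)| ≤ U := abs_le.2 ⟨by linarith, by linarith⟩
  have hxD : |twv - tvv| ≤ D + U := by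
    linarith [abs_sub_abs_le_abs_sub (twv - tvv) (pw - pv)]
  have hdrift := abs_two_mul_sub_le_of_drift hH tvv twv
  have hpos : 0 < ϑ + 1 := by linarith
  have hsplit : 2 * (H twv - H tvv) / (ϑ + 1) - (pw - pv) =
      (2 * (H twv - H tvv) - (ϑ + 1) * (twv - tvv)) / (ϑ + 1) +
        ((twv - tvv) - (pw - pv)) := by
    field_simp
    ring
  calc |2 * (H twv - H tvv) / (ϑ + 1) - (pw - pv)|
      ≤ |2 * (H twv - H tvv) - (ϑ + 1) * (twv - tvv)| / (ϑ + 1) + U := by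
        rw [hsplit]
        refine (abs_add_le _ _).trans ?_
        rw [abs_div, abs_of_pos hpos]
        linarith
    _ ≤ (ϑ - 1) * (D + U) / (ϑ + 1) + U := by
        have := hdrift.trans (mul_le_mul_of_nonneg_left hxD (sub_nonneg.2 hϑ.le))
        gcongr
    _ ≤ ϑ * U + ((ϑ - 1) / (ϑ + 1)) * D := by
        have hfrac : (ϑ - 1) / (ϑ + 1) ≤ ϑ - 1 := div_le_self (by linarith) (by linarith)
        have := mul_le_mul_of_nonneg_right hfrac hU
        rw [mul_div_right_comm]
        linarith
end

section
/- Let ϑ > 1 and let H : ℝ → ℝ satisfy t' − t ≤ H(t') − H(t) ≤ ϑ(t' − t) for all t ≤ t'. Let d ≥ U/2 with U ≥ 0, and let p_v, p_w ∈ ℝ with |p_w − p_v| ≤ D for some D ≥ 0. Suppose t_{wv} ∈ [p_w + d − U, p_w + d] and set τ_{wv} := H(t_{wv}). Then |2(τ_{wv} − H(p_v))/(ϑ+1) − (d − U/2) − (p_w − p_v)| ≤ ϑU/2 + ((ϑ−1)/(ϑ+1))·(D + d). -/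
/-- Error bound for the phase-offset measurement when node `v` estimates its own
pulse arrival time instead of sending a message to itself (Corollary 6). -/
theorem phase_measurement_error_self_estimate
    (ϑ d U D : ℝ) (H : ℝ → ℝ)
    (hϑ : 1 < ϑ)
    (hH : ∀ t t' : ℝ, t ≤ t' →
      t' - t ≤ H t' - H t ∧ H t' - H t ≤ ϑ * (t' - t))
    (hdU : U / 2 ≤ d) (hU : 0 ≤ U) (hD : 0 ≤ D)
    (pv pw : ℝ) (hpD : |pw - pv| ≤ D)
    (twv : ℝ)
    (htwv : pw + d - U ≤ twv ∧ twv ≤ pw + d)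
    (τwv : ℝ) (hτwv : τwv = H twv) :
    |2 * (τwv - H pv) / (ϑ + 1) - (d - U / 2) - (pw - pv)| ≤
      ϑ * U / 2 + ((ϑ - 1) / (ϑ + 1)) * (D + d) := by
  subst hτwv
  obtain ⟨hlo, hhi⟩ := htwv
  obtain ⟨heD, heD'⟩ := abs_le.mp hpD
  have hs : 0 < ϑ + 1 := by linarith
  have hk : 0 ≤ ϑ - 1 := by linarith
  have hUk : 0 ≤ (ϑ - 1) * U := mul_nonneg hk hU
  have hUkk : 0 ≤ (ϑ - 1) * ((ϑ - 1) * U) := mul_nonneg hk hUk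
  have hkd : 0 ≤ (ϑ - 1) * (d - U / 2) := mul_nonneg hk (by linarith)
  have hkD : 0 ≤ (ϑ - 1) * (D - (pw - pv)) := mul_nonneg hk (by linarith)
  have hkD' : 0 ≤ (ϑ - 1) * (D + (pw - pv)) := mul_nonneg hk (by linarith)
  have hxhi : 0 ≤ (ϑ - 1) * (pw + d - twv) := mul_nonneg hk (by linarith)
  have hxlo : 0 ≤ (ϑ - 1) * (twv - (pw + d - U)) := mul_nonneg hk (by linarith)
  have hlhs : 2 * (H twv - H pv) / (ϑ + 1) - (d - U / 2) - (pw - pv) =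
      (2 * (H twv - H pv) - (ϑ + 1) * (d - U / 2 + (pw - pv))) / (ϑ + 1) := by
    field_simp
    ring
  have hrhs : ϑ * U / 2 + ((ϑ - 1) / (ϑ + 1)) * (D + d) =
      ((ϑ + 1) * (ϑ * U / 2) + (ϑ - 1) * (D + d)) / (ϑ + 1) := by
    field_simp
  rw [hlhs, hrhs, abs_div, abs_of_pos hs]
  refine div_le_div_of_nonneg_right (abs_le.mpr ?_) hs.le
  rcases le_total pv twv with h | h
  · obtain ⟨h₁, h₂⟩ := hH pv twv h
    constructor <;> nlinarith
  · obtain ⟨h₁, h₂⟩ := hH twv pv h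
    constructor <;> nlinarith
end

section
/- Let ϑ > 1, T > 0, U ≥ 0, τ₁, τ₁' ∈ ℝ. Let (p_v)_{v∈C} and (p_v')_{v∈C} be reals and (Δ_v)_{v∈C} reals such that: each hardware clock H_v : ℝ → ℝ satisfies t' − t ≤ H_v(t') − H_v(t) ≤ ϑ(t' − t) for t ≤ t'; for every v ∈ C, p_v ≤ p_v' and H_v(p_v') − H_v(p_v) = T − Δ_v + τ₁' − τ₁ ≥ 0; |Δ_v| ≤ ϑ(‖p‖ + U) for every v ∈ C where ‖p‖ is the diameter of (p_v)_{v∈C}; and max_{v,w∈C} ((p_v − Δ_v) − (p_w − Δ_w)) ≤ ((5ϑ−3)/(2(ϑ+1)))·‖p‖ + 2ϑU. Then the diameter of (p_v')_{v∈C} satisfies ‖p'‖ ≤ ((2ϑ² + 5ϑ − 5)/(2(ϑ+1)))·‖p‖ + (3ϑ−1)U + (1 − 1/ϑ)·(T + τ₁' − τ₁). -/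
/-- One round of the phase synchronization algorithm: bound on the new pulse
diameter (Corollary 10 of the paper). -/
theorem phase_sync_iteration
    {ι : Type*} (C : Finset ι) (hCne : C.Nonempty)
    (ϑ T U τ₁ τ₁' : ℝ)
    (hϑ : 1 < ϑ) (hT : 0 < T) (hU : 0 ≤ U)
    (p p' Δ : ι → ℝ) (H : ι → ℝ → ℝ)
    (hH : ∀ v ∈ C, ∀ t t' : ℝ, t ≤ t' →
      t' - t ≤ H v t' - H v t ∧ H v t' - H v t ≤ ϑ * (t' - t))
    (hord : ∀ v ∈ C, p v ≤ p' v)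
    (hwait : ∀ v ∈ C, H v (p' v) - H v (p v) = T - Δ v + τ₁' - τ₁)
    (hwait0 : ∀ v ∈ C, 0 ≤ T - Δ v + τ₁' - τ₁)
    (hΔ : ∀ v ∈ C, |Δ v| ≤ ϑ * ((C.sup' hCne p - C.inf' hCne p) + U))
    (hpair : ∀ v ∈ C, ∀ w ∈ C, (p v - Δ v) - (p w - Δ w) ≤
      ((5 * ϑ - 3) / (2 * (ϑ + 1))) * (C.sup' hCne p - C.inf' hCne p)
        + 2 * ϑ * U) :
    C.sup' hCne p' - C.inf' hCne p' ≤
      ((2 * ϑ ^ 2 + 5 * ϑ - 5) / (2 * (ϑ + 1))) * (C.sup' hCne p - C.inf' hCne p)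
        + (3 * ϑ - 1) * U + (1 - 1 / ϑ) * (T + τ₁' - τ₁) := by
  obtain ⟨v, hv, hv'⟩ := C.exists_mem_eq_sup' hCne p'
  obtain ⟨w, hw, hw'⟩ := C.exists_mem_eq_inf' hCne p'
  rw [hv', hw']
  have hvw := hpair v hv w hw
  have hΔw := hΔ w hw
  generalize C.sup' hCne p - C.inf' hCne p = P at *
  have hϑ0 : 0 < ϑ := by linarith
  have late := (hH v hv _ _ (hord v hv)).1
  have early := (hH w hw _ _ (hord w hw)).2
  rw [hwait v hv] at late
  rw [hwait w hw, mul_comm, ← div_le_iff₀ hϑ0] at early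
  have drift : (1 - 1 / ϑ) * (-Δ w) ≤ (ϑ - 1) * (P + U) := by
    have hfac : 0 ≤ 1 - 1 / ϑ := by
      rw [sub_nonneg, div_le_one hϑ0]
      exact hϑ.le
    calc (1 - 1 / ϑ) * (-Δ w) ≤ (1 - 1 / ϑ) * (ϑ * (P + U)) :=
          mul_le_mul_of_nonneg_left ((neg_le_abs _).trans hΔw) hfac
      _ = (ϑ - 1) * (P + U) := by field_simp
  have coeff : (2 * ϑ ^ 2 + 5 * ϑ - 5) / (2 * (ϑ + 1)) =
      (5 * ϑ - 3) / (2 * (ϑ + 1)) + (ϑ - 1) := by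
    field_simp
    ring
  rw [coeff]
  have split : (T - Δ w + τ₁' - τ₁) / ϑ =
      (T - Δ w + τ₁' - τ₁) - (1 - 1 / ϑ) * (T + τ₁' - τ₁) - (1 - 1 / ϑ) * (-Δ w) := by
    ring
  linarith
end

section
/- Let ϑ > 1, d ≥ U ≥ 0, and τ₁, τ₂ ∈ ℝ. Let (p_v)_{v∈C} be reals with diameter ‖p‖, and for each v ∈ C let H_v : ℝ → ℝ satisfy t' − t ≤ H_v(t') − H_v(t) ≤ ϑ(t' − t) for t ≤ t'. For each v ∈ C let t_v ≤ p_v be its round start time with H_v(p_v) = H_v(t_v) + τ₁. Suppose τ₁ ≥ ϑ(‖p‖ − (d − U)) and τ₂ ≥ ϑ(‖p‖ + d). Then for all v, w ∈ C and any reception time t_{vw} ∈ [p_v + d − U, p_v + d]: (1) t_{vw} ≥ t_w, so H_w(t_{vw}) ≥ H_w(t_w); and (2) H_w(t_{vw}) ≤ H_w(t_w) + τ₁ + τ₂; i.e., w receives v's pulse within its listening window [H_w(t_w), H_w(t_w) + τ₁ + τ₂] of local time. -/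
/-- Correct nodes receive each other's pulses within their listening windows
(part of Lemma 11 of the paper). -/
theorem pulses_received_in_window
    {ι : Type*} (C : Finset ι) (hCne : C.Nonempty)
    (ϑ d U τ₁ τ₂ : ℝ)
    (hϑ : 1 < ϑ) (hU : 0 ≤ U) (hdU : U ≤ d)
    (p t : ι → ℝ) (H : ι → ℝ → ℝ)
    (hH : ∀ v ∈ C, ∀ s s' : ℝ, s ≤ s' →
      s' - s ≤ H v s' - H v s ∧ H v s' - H v s ≤ ϑ * (s' - s))
    (hts : ∀ v ∈ C, t v ≤ p v)
    (hpulse : ∀ v ∈ C, H v (p v) = H v (t v) + τ₁)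
    (hτ₁ : τ₁ ≥ ϑ * ((C.sup' hCne p - C.inf' hCne p) - (d - U)))
    (hτ₂ : τ₂ ≥ ϑ * ((C.sup' hCne p - C.inf' hCne p) + d)) :
    ∀ v ∈ C, ∀ w ∈ C, ∀ tvw : ℝ,
      p v + d - U ≤ tvw → tvw ≤ p v + d →
      (t w ≤ tvw ∧ H w (t w) ≤ H w tvw) ∧
        H w tvw ≤ H w (t w) + τ₁ + τ₂ := by
  intro v hv w hw s hs_lower hs_upper
  have hϑ0 : 0 < ϑ := by linarith
  have hv_sup := C.le_sup' p hv
  have hw_sup := C.le_sup' p hw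
  have hv_inf := C.inf'_le p hv
  have hw_inf := C.inf'_le p hw
  have hwp := hpulse w hw
  have hlead : (C.sup' hCne p - C.inf' hCne p) - (d - U) ≤ p w - t w := by
    refine le_of_mul_le_mul_left ?_ hϑ0
    linarith [(hH w hw (t w) (p w) (hts w hw)).2]
  have hstart : t w ≤ s := by linarith
  refine ⟨⟨hstart, by linarith [(hH w hw (t w) s hstart).1]⟩, ?_⟩
  rcases le_total s (p w) with hsp | hps
  · have hτ₂_nonneg : 0 ≤ τ₂ := le_trans (mul_nonneg hϑ0.le (by linarith)) hτ₂
    linarith [(hH w hw s (p w) hsp).1]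
  · have hlag : ϑ * (s - p w) ≤ ϑ * ((C.sup' hCne p - C.inf' hCne p) + d) :=
      mul_le_mul_of_nonneg_left (by linarith) hϑ0.le
    linarith [(hH w hw (p w) s hps).2]
end

section
/- Let ϑ ≥ 1, ν > 0, T > 0, τ₂ > 0, μ ∈ [1, ϑ²]. Let H : ℝ → ℝ satisfy H(t') − H(t) ≥ t' − t for all t ≤ t', and let h : ℝ → ℝ satisfy |h(t') − h(t)| ≤ ν|t' − t| for all t, t'. Let p ≤ p' with μ·(H(p') − H(p)) = T − Δ for some Δ with |Δ| < τ₂. Then for every t ∈ [p, p']: |μ·h(t) − μ·h((p + p')/2)| < ν(T + τ₂)/2. -/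
/-- Stability of the multiplied clock rate within a round (Lemma 14). -/
theorem rate_stability
    (ϑ ν T τ₂ μ : ℝ)
    (hϑ : 1 ≤ ϑ) (hν : 0 < ν) (hT : 0 < T) (hτ₂ : 0 < τ₂)
    (hμ1 : 1 ≤ μ) (hμ2 : μ ≤ ϑ ^ 2)
    (H h : ℝ → ℝ)
    (hH : ∀ t t' : ℝ, t ≤ t' → t' - t ≤ H t' - H t)
    (hlip : ∀ t t' : ℝ, |h t' - h t| ≤ ν * |t' - t|)
    (p p' Δ : ℝ) (hpp' : p ≤ p')
    (hwait : μ * (H p' - H p) = T - Δ) (hΔ : |Δ| < τ₂)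
    (t : ℝ) (htp : p ≤ t) (htp' : t ≤ p') :
    |μ * h t - μ * h ((p + p') / 2)| < ν * (T + τ₂) / 2 := by
  have hμ0 : 0 ≤ μ := by linarith
  have hmid : |t - (p + p') / 2| ≤ (p' - p) / 2 := by
    rw [abs_le]
    constructor <;> linarith
  have hlen : μ * (p' - p) < T + τ₂ := by
    have := mul_le_mul_of_nonneg_left (hH p p' hpp') hμ0
    linarith [neg_abs_le Δ]
  calc |μ * h t - μ * h ((p + p') / 2)|
      = μ * |h t - h ((p + p') / 2)| := by
        rw [← mul_sub, abs_mul, abs_of_nonneg hμ0]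
    _ ≤ μ * (ν * ((p' - p) / 2)) := by
        gcongr
        exact (hlip _ _).trans (by gcongr)
    _ = ν * (μ * (p' - p)) / 2 := by ring
    _ < ν * (T + τ₂) / 2 := by gcongr
end

section
/- Let ϑ ≥ 1, ν > 0, T ≥ τ₂ > 0, τ₃ > 0, μ ∈ [1, ϑ²]. Let H : ℝ → ℝ be differentiable with derivative h satisfying 1 ≤ h(t) ≤ ϑ and |h(t') − h(t)| ≤ ν|t' − t| for all t, t'. Let p ≤ q ≤ p' with μ·(H(q) − H(p)) = τ₂ + τ₃ and μ·(H(p') − H(p)) = T − Δ for some Δ with |Δ| < τ₂. Set ρ̄ := μ·h((p + p')/2). Then |ρ̄·(q − p) − (τ₂ + τ₃)| < ν·T·(τ₂ + τ₃). -/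
/-- The representative clock rate approximates the real-time span between the
two pulses of a round (Corollary 15 of the paper). -/
theorem rate_times_interval_estimate
    (ϑ ν T τ₂ τ₃ μ : ℝ)
    (hϑ : 1 ≤ ϑ) (hν : 0 < ν) (hτ₂ : 0 < τ₂) (hτ₂T : τ₂ ≤ T) (hτ₃ : 0 < τ₃)
    (hμ1 : 1 ≤ μ) (hμ2 : μ ≤ ϑ ^ 2)
    (H h : ℝ → ℝ)
    (hderiv : ∀ t, HasDerivAt H (h t) t)
    (hrate : ∀ t, 1 ≤ h t ∧ h t ≤ ϑ)
    (hlip : ∀ t t' : ℝ, |h t' - h t| ≤ ν * |t' - t|)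
    (p q p' Δ : ℝ) (hpq : p ≤ q) (hqp' : q ≤ p')
    (hq : μ * (H q - H p) = τ₂ + τ₃)
    (hp' : μ * (H p' - H p) = T - Δ) (hΔ : |Δ| < τ₂)
    (ρ : ℝ) (hρ : ρ = μ * h ((p + p') / 2)) :
    |ρ * (q - p) - (τ₂ + τ₃)| < ν * T * (τ₂ + τ₃) := by
  have hpq_ne : p ≠ q := by
    rintro rfl
    simp only [sub_self, mul_zero] at hq
    linarith
  have hlt : p < q := lt_of_le_of_ne hpq hpq_ne
  have mean_value : ∀ a b : ℝ, a < b → ∃ c ∈ Set.Ioo a b, H b - H a = h c * (b - a) := by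
    intro a b hab
    obtain ⟨c, hc, hslope⟩ := exists_hasDerivAt_eq_slope H h hab
      (fun x _ => (hderiv x).continuousAt.continuousWithinAt) (fun x _ => hderiv x)
    exact ⟨c, hc, by rw [hslope, div_mul_cancel₀ _ (sub_pos.2 hab).ne']⟩
  obtain ⟨ξ, ⟨hpξ, hξq⟩, hξ⟩ := mean_value p q hlt
  obtain ⟨η, -, hη⟩ := mean_value p p' (hlt.trans_le hqp')
  have hμ : 0 < μ := by linarith
  have hspan : μ * (p' - p) ≤ T - Δ := by
    rw [← hp', hη]
    exact mul_le_mul_of_nonneg_left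
      (le_mul_of_one_le_left (by linarith) (hrate η).1) hμ.le
  have hpulse : q - p ≤ τ₂ + τ₃ := by
    rw [← hq, hξ, ← mul_assoc]
    exact le_mul_of_one_le_left (by linarith)
      (one_le_mul_of_one_le_of_one_le hμ1 (hrate ξ).1)
  have hdist : |(p + p') / 2 - ξ| ≤ (p' - p) / 2 := by
    rw [abs_le]
    constructor <;> linarith
  have hdrift : μ * |h ((p + p') / 2) - h ξ| < ν * T := by
    calc μ * |h ((p + p') / 2) - h ξ|
        ≤ μ * (ν * ((p' - p) / 2)) := by
          gcongr
          exact (hlip _ _).trans (mul_le_mul_of_nonneg_left hdist hν.le)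
      _ = ν * (μ * (p' - p) / 2) := by ring
      _ < ν * T := by
          have := (abs_lt.1 hΔ).1
          exact mul_lt_mul_of_pos_left (by linarith) hν
  have herror : ρ * (q - p) - (τ₂ + τ₃) = μ * (h ((p + p') / 2) - h ξ) * (q - p) := by
    rw [hρ, ← hq, hξ]
    ring
  rw [herror, abs_mul, abs_mul, abs_of_pos hμ, abs_of_pos (sub_pos.2 hlt)]
  calc μ * |h ((p + p') / 2) - h ξ| * (q - p)
      < ν * T * (q - p) := mul_lt_mul_of_pos_right hdrift (sub_pos.2 hlt)
    _ ≤ ν * T * (τ₂ + τ₃) :=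
        mul_le_mul_of_nonneg_left hpulse (mul_pos hν (hτ₂.trans_le hτ₂T)).le
end

section
/- Let ϑ ≥ 1, ν > 0, T ≥ τ₂ > 0, τ₃ > 0, U ≥ 0 with (T + τ₂)(τ₂ + τ₃ + U) < 2T(τ₂ + τ₃), and μ ∈ [1, ϑ²]. Let H : ℝ → ℝ be differentiable with derivative h satisfying 1 ≤ h(t) ≤ ϑ and |h(t') − h(t)| ≤ ν|t' − t| for all t, t'. Let p ≤ p' with μ·(H(p') − H(p)) = T − Δ for some |Δ| < τ₂, set ρ̄ := μ·h((p + p')/2), and let t, t' satisfy p ≤ t ≤ t' ≤ p' and t' − t ≤ τ₂ + τ₃ + U. Then |μ·(H(t') − H(t)) − ρ̄·(t' − t)| < ν·T·(τ₂ + τ₃). -/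
/-- The mean value theorem in product form, allowing a degenerate interval. -/
theorem exists_sub_eq_deriv_mul_sub {f f' : ℝ → ℝ} (hf : ∀ x, HasDerivAt f (f' x) x)
    {a b : ℝ} (hab : a ≤ b) : ∃ c ∈ Set.Icc a b, f b - f a = f' c * (b - a) := by
  rcases hab.eq_or_lt with rfl | hlt
  · exact ⟨a, ⟨le_rfl, le_rfl⟩, by ring⟩
  · obtain ⟨c, hc, hslope⟩ := exists_hasDerivAt_eq_slope f f' hlt
      (fun x _ => (hf x).continuousAt.continuousWithinAt) (fun x _ => hf x)
    refine ⟨c, Set.Ioo_subset_Icc_self hc, ?_⟩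
    rw [hslope, div_mul_cancel₀ _ (sub_pos.2 hlt).ne']

/-- The local-time progress between the reception times of the two pulses of a
round is well approximated by the representative clock rate (Corollary 16). -/
theorem local_progress_estimate
    (ϑ ν T τ₂ τ₃ U μ : ℝ)
    (hϑ : 1 ≤ ϑ) (hν : 0 < ν) (hτ₂ : 0 < τ₂) (hτ₂T : τ₂ ≤ T) (hτ₃ : 0 < τ₃)
    (hU : 0 ≤ U)
    (hnum : (T + τ₂) * (τ₂ + τ₃ + U) < 2 * T * (τ₂ + τ₃))
    (hμ1 : 1 ≤ μ) (hμ2 : μ ≤ ϑ ^ 2)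
    (H h : ℝ → ℝ)
    (hderiv : ∀ t, HasDerivAt H (h t) t)
    (hrate : ∀ t, 1 ≤ h t ∧ h t ≤ ϑ)
    (hlip : ∀ t t' : ℝ, |h t' - h t| ≤ ν * |t' - t|)
    (p p' Δ : ℝ) (hpp' : p ≤ p')
    (hp' : μ * (H p' - H p) = T - Δ) (hΔ : |Δ| < τ₂)
    (ρ : ℝ) (hρ : ρ = μ * h ((p + p') / 2))
    (t t' : ℝ) (hpt : p ≤ t) (htt' : t ≤ t') (ht'p' : t' ≤ p')
    (hspan : t' - t ≤ τ₂ + τ₃ + U) :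
    |μ * (H t' - H t) - ρ * (t' - t)| < ν * T * (τ₂ + τ₃) := by
  have hμ0 : 0 ≤ μ := by linarith
  have hround : μ * (p' - p) ≤ T + τ₂ := by
    obtain ⟨c, -, hc⟩ := exists_sub_eq_deriv_mul_sub hderiv hpp'
    have hle : p' - p ≤ H p' - H p := by
      rw [hc]
      exact le_mul_of_one_le_left (sub_nonneg.2 hpp') (hrate c).1
    have := mul_le_mul_of_nonneg_left hle hμ0
    linarith [neg_abs_le Δ]
  obtain ⟨s, ⟨hts, hst'⟩, hs⟩ := exists_sub_eq_deriv_mul_sub hderiv htt'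
  have hdev : |h s - h ((p + p') / 2)| ≤ ν * ((p' - p) / 2) := by
    refine (hlip _ _).trans (mul_le_mul_of_nonneg_left ?_ hν.le)
    rw [abs_le]
    constructor <;> linarith
  calc |μ * (H t' - H t) - ρ * (t' - t)|
      = μ * |h s - h ((p + p') / 2)| * (t' - t) := by
        rw [hs, hρ, ← abs_of_nonneg hμ0, ← abs_mul,
          ← abs_of_nonneg (sub_nonneg.2 htt'), ← abs_mul, abs_of_nonneg hμ0,
          abs_of_nonneg (sub_nonneg.2 htt')]
        ring_nf
    _ ≤ μ * (ν * ((p' - p) / 2)) * (t' - t) := by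
        have := sub_nonneg.2 htt'
        gcongr
    _ = ν / 2 * (μ * (p' - p) * (t' - t)) := by ring
    _ ≤ ν / 2 * ((T + τ₂) * (τ₂ + τ₃ + U)) := by
        have := sub_nonneg.2 htt'
        have : 0 ≤ T + τ₂ := by linarith
        gcongr
    _ < ν / 2 * (2 * T * (τ₂ + τ₃)) := by gcongr
    _ = ν * T * (τ₂ + τ₃) := by ring
end

section
/- Let ϑ̄ ≥ 1, ν > 0, T > 0, U ≥ 0, L > 0, and reals ρ_v, ρ_w ∈ [1, ϑ̄], A > 0, B > 0, m ∈ ℝ satisfying: |B − A| ≤ U; |A/L − 1/ρ_w| < νT/ρ_w; |m/B − ρ_v| < νT; and 0 < m/B ≤ ϑ̄. Then |ρ_w − ρ_v − (1 − m/L)| ≤ ϑ̄·(1 − 1/ϑ̄)² + ϑ̄·U/L + (ϑ̄ + 1)·ν·T. -/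
/-- The error of approximating `x - y` by `1 - y / x`, for `x` and `y` in `[1, t]`. -/
lemma abs_sub_sub_one_sub_div_le {t x y : ℝ} (hx : 1 ≤ x) (hxt : x ≤ t) (hy : 1 ≤ y)
    (hyt : y ≤ t) : |x - y - (1 - y / x)| ≤ t * (1 - 1 / t) ^ 2 := by
  have hx0 : 0 < x := by linarith
  have ht0 : 0 < t := by linarith
  have hl : x - y - (1 - y / x) = (x - 1) * (x - y) / x := by field_simp
  have hr : t * (1 - 1 / t) ^ 2 = (t - 1) ^ 2 / t := by field_simp
  have hp : 0 ≤ x - 1 := sub_nonneg.2 hx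
  have hq : 0 ≤ t - x := sub_nonneg.2 hxt
  rw [hl, hr, abs_le]
  constructor
  · calc -((t - 1) ^ 2 / t) ≤ (x - 1) * (x - t) / x := by
          rw [← neg_div, div_le_div_iff₀ ht0 hx0]
          nlinarith [mul_nonneg hp hq, pow_nonneg hp 3, mul_nonneg (pow_nonneg hp 2) hq,
            sq_nonneg (x - 1), sq_nonneg (t - x)]
      _ ≤ (x - 1) * (x - y) / x := by gcongr
  · calc (x - 1) * (x - y) / x ≤ (x - 1) * (x - 1) / x := by gcongr
      _ ≤ (t - 1) ^ 2 / t := by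
          rw [div_le_div_iff₀ hx0 ht0]
          nlinarith [mul_nonneg hq hp,
            mul_nonneg hq (mul_nonneg hp (hp.trans (sub_le_sub_right hxt 1)))]

/-- Numerical core of the frequency-measurement error bound (Lemma 17). -/
theorem frequency_measurement_error
    (ϑ ν T U L ρv ρw A B m : ℝ)
    (hϑ : 1 ≤ ϑ) (hν : 0 < ν) (hT : 0 < T) (hU : 0 ≤ U) (hL : 0 < L)
    (hρv : 1 ≤ ρv ∧ ρv ≤ ϑ) (hρw : 1 ≤ ρw ∧ ρw ≤ ϑ)
    (hA : 0 < A) (hB : 0 < B)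
    (h1 : |B - A| ≤ U)
    (h2 : |A / L - 1 / ρw| < ν * T / ρw)
    (h3 : |m / B - ρv| < ν * T)
    (h4 : 0 < m / B) (h5 : m / B ≤ ϑ) :
    |ρw - ρv - (1 - m / L)| ≤
      ϑ * (1 - 1 / ϑ) ^ 2 + ϑ * U / L + (ϑ + 1) * ν * T := by
  obtain ⟨hv, hv'⟩ := hρv
  obtain ⟨hw, hw'⟩ := hρw
  have hw0 : 0 < ρw := by linarith
  have hνT : 0 < ν * T := mul_pos hν hT
  have hdrift := abs_sub_sub_one_sub_div_le hw hw' hv hv'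
  have hdelay : |m / B * ((B - A) / L)| ≤ ϑ * (U / L) := by
    rw [abs_mul, abs_of_pos h4, abs_div, abs_of_pos hL]
    gcongr
  have hsender : |m / B * (A / L - 1 / ρw)| ≤ ϑ * (ν * T) := by
    rw [abs_mul, abs_of_pos h4]
    gcongr
    exact h2.le.trans (div_le_self hνT.le hw)
  have hreceiver : |(m / B - ρv) / ρw| ≤ ν * T := by
    rw [abs_div, abs_of_pos hw0]
    exact (div_le_self (abs_nonneg _) hw).trans h3.le
  have hsplit : ρw - ρv - (1 - m / L) = (ρw - ρv - (1 - ρv / ρw)) + m / B * ((B - A) / L) +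
      m / B * (A / L - 1 / ρw) + (m / B - ρv) / ρw := by
    field_simp
    ring
  rw [hsplit, mul_div_assoc]
  rw [abs_le] at *
  constructor <;> linarith
end

section
/- Let ϑ > 1, δ ≥ 0, ε ≥ 2δ + (ϑ − 1)(ϑ³ − 1), and for each v in a finite set C let h_v ∈ [1, ϑ], μ_v ∈ [1, ϑ²], ξ_v ∈ ℝ, and set ρ_v := μ_v·h_v and R := max_{u∈C} ρ_u − min_{u∈C} ρ_u (note R ≤ ϑ³ − 1). Assume: (a) for all v, w ∈ C, |(ρ_v + ξ_v) − (ρ_w + ξ_w)| ≤ R/2 + 2δ; (b) for all v ∈ C, min_{u∈C} ρ_u − δ ≤ ρ_v + ξ_v ≤ max_{u∈C} ρ_u + δ; (c) for all v ∈ C, |ξ_v| ≤ R + δ. Define μ̂_v := μ_v + 2ξ_v/(ϑ + 1). Then: (1) for all v, w ∈ C, |μ̂_v·h_v − μ̂_w·h_w| ≤ ((2ϑ − 1)/2)·R + ϑ·ε; (2) for all v ∈ C, (μ̂_v − ε)·h_v ≤ max_{u∈C} ρ_u − ε/2 and (μ̂_v + ε)·h_v ≥ min_{u∈C} ρ_u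 + ε/2. -/
/-- The rate change `c * x` caused by a frequency correction `x`, scaled by `c = 2 * h / (ϑ + 1)`,
overshoots the interval allowed for the unscaled correction by at most `(h - 1 / 2) * ε`. -/
lemma scaled_correction_le {ϑ δ ε h R x r M : ℝ} (hϑ : 1 < ϑ) (hδ : 0 ≤ δ)
    (hε : 2 * δ + (ϑ - 1) * (ϑ ^ 3 - 1) ≤ ε) (h1 : 1 ≤ h) (h2 : h ≤ ϑ)
    (hR : R ≤ ϑ ^ 3 - 1) (hr : r ≤ M) (hrx : r + x ≤ M + δ) (hx : x ≤ R + δ) :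
    r + 2 * h / (ϑ + 1) * x ≤ M + (h - 1 / 2) * ε := by
  have hP : 0 ≤ (ϑ - 1) * (ϑ ^ 3 - 1) :=
    mul_nonneg (by linarith) (by linarith [one_le_pow₀ hϑ.le (n := 3)])
  have hε2 : 1 / 2 * ε ≤ (h - 1 / 2) * ε := by
    apply mul_le_mul_of_nonneg_right <;> linarith
  have hc0 : 0 ≤ 2 * h / (ϑ + 1) := by positivity
  rcases le_total x 0 with hx0 | hx0
  · linarith [mul_nonpos_of_nonneg_of_nonpos hc0 hx0]
  rcases le_total (2 * h / (ϑ + 1)) 1 with hc | hc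
  · linarith [mul_le_mul_of_nonneg_right hc hx0]
  have hcϑ : 2 * h / (ϑ + 1) - 1 ≤ (ϑ - 1) / 2 := by
    rw [sub_le_iff_le_add, div_le_iff₀ (by linarith)]
    nlinarith [sq_nonneg (ϑ - 1)]
  have hch : 2 * h / (ϑ + 1) ≤ h := by
    rw [div_le_iff₀ (by linarith)]
    nlinarith
  have hkx : (2 * h / (ϑ + 1) - 1) * x ≤ (2 * h / (ϑ + 1) - 1) * (ϑ ^ 3 - 1 + δ) :=
    mul_le_mul_of_nonneg_left (by linarith) (by linarith)
  have hkR : (2 * h / (ϑ + 1) - 1) * (ϑ ^ 3 - 1) ≤ (ϑ - 1) / 2 * (ϑ ^ 3 - 1) :=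
    mul_le_mul_of_nonneg_right hcϑ (by linarith [one_le_pow₀ hϑ.le (n := 3)])
  have hkδ : (2 * h / (ϑ + 1) - 1) * δ ≤ (h - 1) * δ :=
    mul_le_mul_of_nonneg_right (by linarith) hδ
  have hδε : (h - 1) * δ ≤ (h - 1) * ε :=
    mul_le_mul_of_nonneg_left (by linarith) (by linarith)
  linarith

/-- The scaling factor `2 * h / (ϑ + 1)` deviates from `1` by at most `(ϑ - 1) / 2`. -/
lemma abs_scaling_sub_one_le {ϑ h : ℝ} (hϑ : 1 < ϑ) (h1 : 1 ≤ h) (h2 : h ≤ ϑ) :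
    |2 * h / (ϑ + 1) - 1| ≤ (ϑ - 1) / 2 := by
  rw [abs_le, neg_le_sub_iff_le_add, sub_le_iff_le_add, div_le_iff₀ (by linarith),
    ← sub_le_iff_le_add, le_div_iff₀ (by linarith)]
  constructor <;> nlinarith [sq_nonneg (ϑ - 1)]

/-- Properties of the tentative new multipliers computed by the frequency
correction step (Lemma 18 of the paper). -/
theorem tentative_multiplier_properties
    {ι : Type*} (C : Finset ι) (hCne : C.Nonempty)
    (ϑ δ ε : ℝ) (hϑ : 1 < ϑ) (hδ : 0 ≤ δ)
    (hε : ε ≥ 2 * δ + (ϑ - 1) * (ϑ ^ 3 - 1))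
    (h μ ξ : ι → ℝ)
    (hh : ∀ v ∈ C, 1 ≤ h v ∧ h v ≤ ϑ)
    (hμ : ∀ v ∈ C, 1 ≤ μ v ∧ μ v ≤ ϑ ^ 2)
    (ρ : ι → ℝ) (hρ : ∀ v, ρ v = μ v * h v)
    (R : ℝ) (hR : R = C.sup' hCne ρ - C.inf' hCne ρ)
    (ha : ∀ v ∈ C, ∀ w ∈ C, |(ρ v + ξ v) - (ρ w + ξ w)| ≤ R / 2 + 2 * δ)
    (hb : ∀ v ∈ C,
      C.inf' hCne ρ - δ ≤ ρ v + ξ v ∧ ρ v + ξ v ≤ C.sup' hCne ρ + δ)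
    (hc : ∀ v ∈ C, |ξ v| ≤ R + δ)
    (μhat : ι → ℝ) (hμhat : ∀ v, μhat v = μ v + 2 * ξ v / (ϑ + 1)) :
    (∀ v ∈ C, ∀ w ∈ C,
      |μhat v * h v - μhat w * h w| ≤ ((2 * ϑ - 1) / 2) * R + ϑ * ε) ∧
    (∀ v ∈ C,
      (μhat v - ε) * h v ≤ C.sup' hCne ρ - ε / 2 ∧
      (μhat v + ε) * h v ≥ C.inf' hCne ρ + ε / 2) := by
  have hle : ∀ v ∈ C, ρ v ≤ C.sup' hCne ρ := fun v hv => Finset.le_sup' ρ hv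
  have hge : ∀ v ∈ C, C.inf' hCne ρ ≤ ρ v := fun v hv => Finset.inf'_le ρ hv
  have hsup : C.sup' hCne ρ ≤ ϑ ^ 3 := by
    refine Finset.sup'_le hCne ρ fun v hv => ?_
    rw [hρ, pow_succ]
    exact mul_le_mul (hμ v hv).2 (hh v hv).2 (by linarith [(hh v hv).1]) (by positivity)
  have hinf : 1 ≤ C.inf' hCne ρ := by
    refine Finset.le_inf' hCne ρ fun v hv => ?_
    rw [hρ]
    exact one_le_mul_of_one_le_of_one_le (hμ v hv).1 (hh v hv).1
  have hR3 : R ≤ ϑ ^ 3 - 1 := by linarith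
  have hP : 0 ≤ (ϑ - 1) * (ϑ ^ 3 - 1) :=
    mul_nonneg (by linarith) (by linarith [one_le_pow₀ hϑ.le (n := 3)])
  have hrate : ∀ v, μhat v * h v = ρ v + 2 * h v / (ϑ + 1) * ξ v := fun v => by
    rw [hμhat, hρ]
    ring
  refine ⟨fun v hv w hw => ?_, fun v hv => ⟨?_, ?_⟩⟩
  · have hdev : ∀ u ∈ C, |(2 * h u / (ϑ + 1) - 1) * ξ u| ≤ (ϑ - 1) / 2 * (R + δ) :=
      fun u hu => by
        rw [abs_mul]
        exact mul_le_mul (abs_scaling_sub_one_le hϑ (hh u hu).1 (hh u hu).2) (hc u hu)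
          (abs_nonneg _) (by linarith)
    have hεϑ : ϑ * (2 * δ) ≤ ϑ * ε := mul_le_mul_of_nonneg_left (by linarith) (by linarith)
    have hδϑ : δ ≤ ϑ * δ := le_mul_of_one_le_left hδ hϑ.le
    have hvw := abs_le.1 (ha v hv w hw)
    have hv' := abs_le.1 (hdev v hv)
    have hw' := abs_le.1 (hdev w hw)
    rw [hrate, hrate, abs_le]
    constructor <;> linarith
  · have := scaled_correction_le hϑ hδ hε (hh v hv).1 (hh v hv).2 hR3 (hle v hv) (hb v hv).2
      (abs_le.1 (hc v hv)).2
    linarith [hrate v]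
  · have := scaled_correction_le (x := -ξ v) (r := -ρ v) (M := -C.inf' hCne ρ) hϑ hδ hε
      (hh v hv).1 (hh v hv).2 hR3 (by linarith [hge v hv]) (by linarith [(hb v hv).1])
      (by linarith [(abs_le.1 (hc v hv)).1])
    linarith [hrate v]
end

section
/- Let ϑ > 1 and ε > 0. For each v in a finite set C, let h_v ∈ [1, ϑ], μ_v ∈ [1, ϑ²], and μ̂_v ∈ ℝ; set ρ_v := μ_v·h_v and R := max_{u∈C} ρ_u − min_{u∈C} ρ_u. Define the clamped new multiplier μ_v' := max{μ̂_v + ε, 1} if μ̂_v ≤ ϑ, and μ_v' := min{μ̂_v − ε, ϑ²} otherwise. Assume: (a) for all v, w ∈ C, |μ̂_v·h_v − μ̂_w·h_w| ≤ ((2ϑ − 1)/2)·R + ϑ·ε; (b) for all v ∈ C, (μ̂_v − ε)·h_v ≤ max_{u∈C} ρ_u − ε/2; (c) for all v ∈ C, (μ̂_v + ε)·h_v ≥ min_{u∈C} ρ_u + ε/2. Then max_{v,w∈C} |μ_v'·h_v − μ_w'·h_w| ≤ max{((2ϑ − 1)/2)·R + 3ϑ·ε, R − ε/2}. -/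
/-- One-sided form of the bound: the difference of two clamped effective rates, where `M` and `m`
are the largest and smallest effective rates before the update and `D` bounds the difference of the
tentative effective rates. -/
lemma clamped_rate_sub_le {ϑ ε M m D hv hw μv μw av aw : ℝ} (hϑ : 1 < ϑ) (hε : 0 < ε)
    (hv1 : 1 ≤ hv) (hvϑ : hv ≤ ϑ) (hw1 : 1 ≤ hw) (hwϑ : hw ≤ ϑ)
    (hμv : 1 ≤ μv) (hμw : μw ≤ ϑ ^ 2) (hvM : μv * hv ≤ M) (hmw : m ≤ μw * hw)
    (hD : 0 ≤ D) (ha : av * hv - aw * hw ≤ D + ϑ * ε)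
    (hb : (av - ε) * hv ≤ M - ε / 2) (hc : m + ε / 2 ≤ (aw + ε) * hw) :
    (if av ≤ ϑ then max (av + ε) 1 else min (av - ε) (ϑ ^ 2)) * hv -
        (if aw ≤ ϑ then max (aw + ε) 1 else min (aw - ε) (ϑ ^ 2)) * hw ≤
      max (D + 3 * ϑ * ε) (M - m - ε / 2) := by
  have hεϑ : ε ≤ ϑ * ε := by nlinarith
  have hεv : ε * hv ≤ ϑ * ε := by nlinarith
  have hεw : ε * hw ≤ ϑ * ε := by nlinarith
  have hεv0 : 0 ≤ ε * hv := by positivity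
  have hεw0 : 0 ≤ ε * hw := by positivity
  have hvM' : hv ≤ M := by nlinarith
  have hmw' : m ≤ ϑ ^ 2 * hw := by nlinarith
  have hϑw : ϑ ^ 2 ≤ ϑ ^ 2 * hw := by nlinarith [sq_nonneg ϑ]
  have hϑϑ : ϑ ≤ ϑ ^ 2 := by nlinarith
  have key : ∀ x y : ℝ, x - y ≤ D + 3 * ϑ * ε ∨ x - y ≤ M - m - ε / 2 →
      x - y ≤ max (D + 3 * ϑ * ε) (M - m - ε / 2) := fun x y => le_max_iff.2
  apply key
  by_cases hav : av ≤ ϑ <;> by_cases haw : aw ≤ ϑ <;>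
    simp only [hav, haw, if_true, if_false]
  · have hw' : (aw + ε) * hw ≤ max (aw + ε) 1 * hw := by gcongr; exact le_max_left _ _
    rcases max_cases (av + ε) 1 with ⟨h, _⟩ | ⟨h, _⟩ <;> rw [h]
    · left; linarith
    · right; linarith
  · left
    rw [not_le] at haw
    have hv' : max (av + ε) 1 * hv ≤ ϑ ^ 2 + ϑ * ε := by
      rcases max_cases (av + ε) 1 with ⟨h, _⟩ | ⟨h, _⟩ <;> rw [h]
      · nlinarith
      · linarith
    rcases min_cases (aw - ε) (ϑ ^ 2) with ⟨h, _⟩ | ⟨h, _⟩ <;> rw [h]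
    · rcases max_cases (av + ε) 1 with ⟨h, _⟩ | ⟨h, _⟩ <;> rw [h]
      · linarith
      · nlinarith
    · linarith
  · left
    have hv' : min (av - ε) (ϑ ^ 2) * hv ≤ (av - ε) * hv := by gcongr; exact min_le_left _ _
    have hw' : (aw + ε) * hw ≤ max (aw + ε) 1 * hw := by gcongr; exact le_max_left _ _
    linarith
  · have hv' : min (av - ε) (ϑ ^ 2) * hv ≤ (av - ε) * hv := by gcongr; exact min_le_left _ _
    rcases min_cases (aw - ε) (ϑ ^ 2) with ⟨h, _⟩ | ⟨h, _⟩ <;> rw [h]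
    · left; linarith
    · right; linarith


/-- Convergence of the effective clock rates after the pull-back and clamping of
the new multipliers (Lemma 19 of the paper). -/
theorem clamped_multiplier_convergence
    {ι : Type*} (C : Finset ι) (hCne : C.Nonempty)
    (ϑ ε : ℝ) (hϑ : 1 < ϑ) (hε : 0 < ε)
    (h μ μhat : ι → ℝ)
    (hh : ∀ v ∈ C, 1 ≤ h v ∧ h v ≤ ϑ)
    (hμ : ∀ v ∈ C, 1 ≤ μ v ∧ μ v ≤ ϑ ^ 2)
    (ρ : ι → ℝ) (hρ : ∀ v, ρ v = μ v * h v)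
    (R : ℝ) (hR : R = C.sup' hCne ρ - C.inf' hCne ρ)
    (μ' : ι → ℝ)
    (hμ' : ∀ v, μ' v =
      if μhat v ≤ ϑ then max (μhat v + ε) 1 else min (μhat v - ε) (ϑ ^ 2))
    (ha : ∀ v ∈ C, ∀ w ∈ C,
      |μhat v * h v - μhat w * h w| ≤ ((2 * ϑ - 1) / 2) * R + ϑ * ε)
    (hb : ∀ v ∈ C, (μhat v - ε) * h v ≤ C.sup' hCne ρ - ε / 2)
    (hc : ∀ v ∈ C, (μhat v + ε) * h v ≥ C.inf' hCne ρ + ε / 2) :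
    ∀ v ∈ C, ∀ w ∈ C,
      |μ' v * h v - μ' w * h w| ≤
        max (((2 * ϑ - 1) / 2) * R + 3 * ϑ * ε) (R - ε / 2) := by
  have hle : ∀ v ∈ C, ρ v ≤ C.sup' hCne ρ := fun v hv => Finset.le_sup' ρ hv
  have hge : ∀ v ∈ C, C.inf' hCne ρ ≤ ρ v := fun v hv => Finset.inf'_le ρ hv
  have hR0 : 0 ≤ R := by
    obtain ⟨u, hu⟩ := hCne
    linarith [hle u hu, hge u hu]
  have hD : 0 ≤ (2 * ϑ - 1) / 2 * R := mul_nonneg (by linarith) hR0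
  have oneSided : ∀ v ∈ C, ∀ w ∈ C, μ' v * h v - μ' w * h w ≤
      max (((2 * ϑ - 1) / 2) * R + 3 * ϑ * ε) (R - ε / 2) := by
    intro v hv w hw
    rw [hμ' v, hμ' w]
    have hbound := clamped_rate_sub_le hϑ hε (hh v hv).1 (hh v hv).2 (hh w hw).1 (hh w hw).2
      (hμ v hv).1 (hμ w hw).2 (hρ v ▸ hle v hv) (hρ w ▸ hge w hw) hD
      (le_of_abs_le (ha v hv w hw)) (hb v hv) (hc w hw)
    rwa [← hR] at hbound
  intro v hv w hw
  exact abs_sub_le_iff.2 ⟨oneSided v hv w hw, oneSided w hw v hv⟩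
end

section
/- Let 0 ≤ β < 1 and a, b, ε be reals with a ≥ 0 and 0 ≤ b < ε/2. Let x : ℕ → ℝ be a nonnegative sequence satisfying x(r+1) ≤ max{β·x(r) + a, x(r) − ε/2} + b for all r ≥ 1. Then limsup_{r→∞} x(r) ≤ (a + b)/(1 − β). -/
open Filter

/-- A real sequence that decreases by at least `d > 0` per step until it is at most `M` is
eventually at most `M`. -/
theorem eventually_le_of_le_max_sub {x : ℕ → ℝ} {M d : ℝ} {N : ℕ} (hd : 0 < d)
    (h : ∀ r ≥ N, x (r + 1) ≤ max M (x r - d)) : ∀ᶠ r in atTop, x r ≤ M := by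
  have key : ∀ n : ℕ, x (N + n) ≤ max M (x N - n * d) := by
    intro n
    induction n with
    | zero => simp
    | succ n ih =>
      refine (h (N + n) (Nat.le_add_right N n)).trans (max_le (le_max_left _ _) ?_)
      push_cast
      rcases le_max_iff.1 ih with ih | ih
      · exact le_max_of_le_left (by linarith)
      · exact le_max_of_le_right (by linarith)
  obtain ⟨n₀, hn₀⟩ := exists_nat_gt ((x N - M) / d)
  filter_upwards [eventually_ge_atTop (N + n₀)] with r hr
  obtain ⟨n, rfl⟩ := Nat.exists_eq_add_of_le (le_of_add_le_left hr)
  have hn : (n₀ : ℝ) ≤ n := by exact_mod_cast Nat.le_of_add_le_add_left hr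
  refine (key n).trans (max_le le_rfl ?_)
  linarith [(div_lt_iff₀ hd).1 (hn₀.trans_le hn)]

/-- Convergence of the effective clock rate diameter (Corollary 21). -/
theorem rate_diameter_limsup
    (β a b ε : ℝ)
    (hβ0 : 0 ≤ β) (hβ1 : β < 1) (ha : 0 ≤ a) (hb0 : 0 ≤ b) (hbε : b < ε / 2)
    (x : ℕ → ℝ) (hx : ∀ r, 0 ≤ x r)
    (hrec : ∀ r ≥ 1, x (r + 1) ≤ max (β * x r + a) (x r - ε / 2) + b) :
    limsup x atTop ≤ (a + b) / (1 - β) := by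
  have hβ : 0 < 1 - β := sub_pos.2 hβ1
  have hcob : IsCoboundedUnder (· ≤ ·) atTop x :=
    IsCoboundedUnder.of_frequently_ge (a := 0) (Eventually.of_forall hx).frequently
  refine le_of_forall_pos_le_add fun δ hδ => limsup_le_of_le hcob ?_
  have hL : (1 - β) * ((a + b) / (1 - β)) = a + b := mul_div_cancel₀ _ hβ.ne'
  set L := (a + b) / (1 - β)
  have hd : 0 < min ((1 - β) * δ) (ε / 2 - b) := lt_min (mul_pos hβ hδ) (sub_pos.2 hbε)
  refine eventually_le_of_le_max_sub (N := 1) hd fun r hr => (hrec r hr).trans ?_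
  rw [← max_add_add_right]
  refine max_le ?_ (le_max_of_le_right ?_)
  · rcases le_total (x r) (L + δ) with h | h
    · exact le_max_of_le_left (by nlinarith [mul_le_mul_of_nonneg_left h hβ0])
    · refine le_max_of_le_right ?_
      have := min_le_left ((1 - β) * δ) (ε / 2 - b)
      nlinarith [mul_le_mul_of_nonneg_left h hβ.le]
  · linarith [min_le_right ((1 - β) * δ) (ε / 2 - b)]
end

section
/- Let ϑ̄ > 1, T > 0, U ≥ 0. Let (p_v)_{v∈C} and (p_v')_{v∈C} be reals, (Δ_v)_{v∈C} reals, and (ρ_v)_{v∈C} reals with ρ_v ∈ [1, ϑ̄], such that for every v ∈ C: p_v' − p_v = (T − Δ_v)/ρ_v ≥ 0 and |Δ_v| ≤ ϑ̄·(‖p‖ + U), where ‖p‖ is the diameter of (p_v)_{v∈C}. Assume further max_{v,w∈C} ((p_v − Δ_v) − (p_w − Δ_w)) ≤ ((5ϑ̄ − 3)/(2(ϑ̄ + 1)))·‖p‖ + 2ϑ̄·U, and set R := max_{v∈C} ρ_v − min_{v∈C} ρ_v. Then the diameter of (p_v')_{v∈C} satisfies ‖p'‖ ≤ ((4ϑ̄²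 + 5ϑ̄ − 7)/(2(ϑ̄ + 1)))·‖p‖ + (4ϑ̄ − 2)·U + R·T. -/
/-- The error caused by applying a correction `d` at a clock rate `r ∈ [1, θ]` instead of rate `1`. -/
lemma abs_mul_one_sub_inv_le {d r θ B : ℝ} (hr : 1 ≤ r) (hrθ : r ≤ θ) (hd : |d| ≤ θ * B) :
    |d * (1 - r⁻¹)| ≤ (θ - 1) * B := by
  have hr0 : 0 < r := by linarith
  have hθ : 0 < θ := by linarith
  have h0 : 0 ≤ 1 - r⁻¹ := sub_nonneg.2 (inv_le_one_of_one_le₀ hr)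
  have h1 : 1 - r⁻¹ ≤ 1 - θ⁻¹ := sub_le_sub_left (inv_anti₀ hr0 hrθ) 1
  calc |d * (1 - r⁻¹)| = |d| * (1 - r⁻¹) := by rw [abs_mul, abs_of_nonneg h0]
    _ ≤ θ * B * (1 - θ⁻¹) := mul_le_mul hd h1 h0 ((abs_nonneg d).trans hd)
    _ = (θ - 1) * B := by field_simp

/-- Inversion is nonexpansive on `[1, ∞)`, with an upper bound given in one-sided form. -/
lemma inv_sub_inv_le_of_sub_le {a b R : ℝ} (ha : 1 ≤ a) (hb : 1 ≤ b) (hR : 0 ≤ R)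
    (h : b - a ≤ R) : a⁻¹ - b⁻¹ ≤ R := by
  have ha0 : 0 < a := by linarith
  have hb0 : 0 < b := by linarith
  rw [inv_sub_inv ha0.ne' hb0.ne', div_le_iff₀ (mul_pos ha0 hb0)]
  exact h.trans (le_mul_of_one_le_right hR (one_le_mul_of_one_le_of_one_le ha hb))

/-- One round of the phase-and-frequency synchronization algorithm: bound on the
new pulse diameter in terms of the old one and the rate diameter (Lemma 22). -/
theorem phase_freq_iteration
    {ι : Type*} (C : Finset ι) (hCne : C.Nonempty)
    (ϑ T U : ℝ)
    (hϑ : 1 < ϑ) (hT : 0 < T) (hU : 0 ≤ U)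
    (p p' Δ ρ : ι → ℝ)
    (hρ : ∀ v ∈ C, 1 ≤ ρ v ∧ ρ v ≤ ϑ)
    (hround : ∀ v ∈ C, p' v - p v = (T - Δ v) / ρ v)
    (hround0 : ∀ v ∈ C, 0 ≤ (T - Δ v) / ρ v)
    (hΔ : ∀ v ∈ C, |Δ v| ≤ ϑ * ((C.sup' hCne p - C.inf' hCne p) + U))
    (hpair : ∀ v ∈ C, ∀ w ∈ C, (p v - Δ v) - (p w - Δ w) ≤
      ((5 * ϑ - 3) / (2 * (ϑ + 1))) * (C.sup' hCne p - C.inf' hCne p)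
        + 2 * ϑ * U)
    (R : ℝ) (hR : R = C.sup' hCne ρ - C.inf' hCne ρ) :
    C.sup' hCne p' - C.inf' hCne p' ≤
      ((4 * ϑ ^ 2 + 5 * ϑ - 7) / (2 * (ϑ + 1)))
          * (C.sup' hCne p - C.inf' hCne p)
        + (4 * ϑ - 2) * U + R * T := by
  obtain ⟨v, hv, hpv⟩ := C.exists_mem_eq_sup' hCne p'
  obtain ⟨w, hw, hpw⟩ := C.exists_mem_eq_inf' hCne p'
  rw [hpv, hpw]
  set D := C.sup' hCne p - C.inf' hCne p
  have hR0 : 0 ≤ R := by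
    linarith [C.le_sup' ρ hv, C.inf'_le ρ hv]
  have hRvw : ρ w - ρ v ≤ R := by
    linarith [C.le_sup' ρ hw, C.inf'_le ρ hv]
  have hrate := mul_le_mul_of_nonneg_right
    (inv_sub_inv_le_of_sub_le (hρ v hv).1 (hρ w hw).1 hR0 hRvw) hT.le
  have hcv := (abs_le.1 (abs_mul_one_sub_inv_le (hρ v hv).1 (hρ v hv).2 (hΔ v hv))).2
  have hcw := (abs_le.1 (abs_mul_one_sub_inv_le (hρ w hw).1 (hρ w hw).2 (hΔ w hw))).1
  have hrv := hround v hv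
  have hrw := hround w hw
  rw [div_eq_mul_inv] at hrv hrw
  have hcoef : (4 * ϑ ^ 2 + 5 * ϑ - 7) / (2 * (ϑ + 1))
      = (5 * ϑ - 3) / (2 * (ϑ + 1)) + 2 * (ϑ - 1) := by
    have : ϑ + 1 ≠ 0 := by linarith
    field_simp
    ring
  rw [hcoef]
  linarith [hpair v hv w hw]
end
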